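/- arXiv:0903.0339 — 3 statements merged into one kernel-verified Lean document; each statement's English description precedes it below -/
import Mathlib

section
/- Let k be a field, A = k[X]/(X^p), B = k[Y]/(Y^q), with x, y the images of X, Y in A tensor_k B and M its maximal ideal. Let u = c*x + d*y + w where c, d are nonzero elements of k and w lies in M^2. Then x^r * y^s is divisible by u in A tensor_k B if and only if r + s >= min(p, q). -/
open TensorProduct Polynomial

theorem aux_back {k R : Type*} [Field k] [CommRing R] [Algebra k R] (x y : R) (p q r s : ℕ)
    (c d : k) (hc : c ≠ 0) (hd : d ≠ 0) (hx : x ^ p = 0) (hy : y ^ q = 0)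
    (w : R) (hw : w ∈ (Ideal.span {x, y}) ^ 2) (h : min p q ≤ r + s) :
    (c • x + d • y + w) ∣ x ^ r * y ^ s := by
  have hw' : ∃ a b, a ∈ Ideal.span {x, y} ∧ b ∈ Ideal.span {x, y} ∧ w = a * x + b * y := by
    rw [pow_two] at hw
    induction hw using Submodule.mul_induction_on' with
    | mem_mul_mem m hm n hn =>
      obtain ⟨a, b, rfl⟩ := Ideal.mem_span_pair.1 hn
      exact ⟨m * a, m * b, Ideal.mul_mem_right _ _ hm, Ideal.mul_mem_right _ _ hm, by ring⟩
    | add m _ n _ h1 h2 =>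
      obtain ⟨a, b, ha, hb, rfl⟩ := h1
      obtain ⟨a', b', ha', hb', rfl⟩ := h2
      exact ⟨a + a', b + b', add_mem ha ha', add_mem hb hb', by ring⟩
  obtain ⟨a, b, ha, hb, rfl⟩ := hw'
  have nil : ∀ z ∈ Ideal.span {x, y}, IsNilpotent z := by
    intro z hz
    have : Ideal.span {x, y} ≤ nilradical R := by
      rw [Ideal.span_le]
      rintro z (rfl | rfl)
      · exact ⟨p, hx⟩
      · exact ⟨q, hy⟩
    exact this hz
  have uni : ∀ e : k, e ≠ 0 → ∀ z ∈ Ideal.span {x, y}, IsUnit (algebraMap k R e + z) := by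
    intro e he z hz
    have h1 : IsUnit (algebraMap k R e) := (IsUnit.mk0 e he).map _
    exact (nil z hz).isUnit_add_left_of_commute h1 (Commute.all _ _)
  obtain ⟨g, hg⟩ := (uni c hc a ha).exists_left_inv
  obtain ⟨g', hg'⟩ := (uni d hd b hb).exists_left_inv
  set u := c • x + d • y + (a * x + b * y) with hu
  have hu' : u = (algebraMap k R c + a) * x + (algebraMap k R d + b) * y := by
    rw [hu, Algebra.smul_def, Algebra.smul_def]; ring
  let π := Ideal.Quotient.mk (Ideal.span {u})
  rw [← Ideal.mem_span_singleton, ← Ideal.Quotient.eq_zero_iff_mem]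
  have h0 : π u = 0 := Ideal.Quotient.eq_zero_iff_mem.2 (Ideal.mem_span_singleton_self u)
  have h0 := (congrArg π hu').symm.trans h0
  simp only [map_add, map_mul] at h0
  have hg2 := congrArg π hg
  have hg3 := congrArg π hg'
  simp only [map_add, map_mul, map_one] at hg2 hg3
  have e1 : π x = (-(π g * (π (algebraMap k R d) + π b))) * π y := by
    linear_combination (π g) * h0 - π x * hg2
  have e2 : π y = (-(π g' * (π (algebraMap k R c) + π a))) * π x := by
    linear_combination (π g') * h0 - π y * hg3
  have hx' : π x ^ p = 0 := by rw [← map_pow, hx, map_zero]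
  have hy' : π y ^ q = 0 := by rw [← map_pow, hy, map_zero]
  change π (x ^ r * y ^ s) = 0
  rw [map_mul, map_pow, map_pow]
  rcases min_le_iff.1 h with h | h
  · rw [e2, mul_pow, mul_left_comm, ← pow_add, pow_eq_zero_of_le h hx', mul_zero]
  · rw [e1, mul_pow, mul_assoc, ← pow_add, pow_eq_zero_of_le h hy', mul_zero]

universe u v

theorem aux_forw {k : Type u} {R : Type v} [Field k] [CommRing R] [Algebra k R] (x y : R)
    (p q r s : ℕ)
    (c d : k) (hd : d ≠ 0) (hc : c ≠ 0)
    (lift : ∀ {S : Type u} [CommRing S] [Algebra k S] (a b : S), a ^ p = 0 → b ^ q = 0 →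
      ∃ f : R →ₐ[k] S, f x = a ∧ f y = b)
    (ext : ∀ {S : Type u} [CommRing S] [Algebra k S] (f g : R →ₐ[k] S), f x = g x → f y = g y →
      f = g)
    (w : R) (hw : w ∈ (Ideal.span {x, y}) ^ 2)
    (h : (c • x + d • y + w) ∣ x ^ r * y ^ s)
    (S : Type u) [CommRing S] [Algebra k S] (t : S) (m : ℕ) (hm : m = min p q)
    (ht : t ^ m = 0) : t ^ (r + s) = 0 := by
  subst hm
  have unit_d : (algebraMap k S d⁻¹) * algebraMap k S d = 1 := by
    rw [← map_mul, inv_mul_cancel₀ hd, map_one]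
  have inM : ∀ f : R →ₐ[k] S, f x = t → t ∣ f y → ∀ z ∈ Ideal.span {x, y}, t ∣ f z := by
    intro f h1 h2 z hz
    obtain ⟨a, b, rfl⟩ := Ideal.mem_span_pair.1 hz
    rw [map_add, map_mul, map_mul, h1]
    exact dvd_add (dvd_mul_left _ _) (h2.mul_left _)
  have inM2 : ∀ f : R →ₐ[k] S, f x = t → t ∣ f y → ∀ z ∈ (Ideal.span {x, y}) ^ 2,
      t * t ∣ f z := by
    intro f h1 h2 z hz
    rw [pow_two] at hz
    induction hz using Submodule.mul_induction_on' with
    | mem_mul_mem m hm n hn =>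
      rw [map_mul]
      exact mul_dvd_mul (inM f h1 h2 _ hm) (inM f h1 h2 _ hn)
    | add m _ n _ h1 h2 => rw [map_add]; exact dvd_add h1 h2
  have diff : ∀ f g : R →ₐ[k] S, f x = g x → ∀ z, f y - g y ∣ f z - g z := by
    intro f g h1 z
    let π := Ideal.Quotient.mkₐ k (Ideal.span {f y - g y})
    have : π.comp f = π.comp g := by
      apply ext
      · simp [h1]
      · simp only [AlgHom.comp_apply]
        exact (Ideal.Quotient.eq).2 (Ideal.mem_span_singleton_self _)
    have h3 : π (f z) = π (g z) := DFunLike.congr_fun this z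
    exact Ideal.mem_span_singleton.1 ((Ideal.Quotient.eq).1 h3)
  have diff2 : ∀ f g : R →ₐ[k] S, f x = t → g x = t → t ∣ f y → t ∣ g y →
      ∀ z ∈ (Ideal.span {x, y}) ^ 2, (f y - g y) * t ∣ f z - g z := by
    intro f g h1 h2 h3 h4 z hz
    have D := diff f g (h1.trans h2.symm)
    rw [pow_two] at hz
    induction hz using Submodule.mul_induction_on' with
    | mem_mul_mem m hm n hn =>
      rw [map_mul, map_mul, show f m * f n - g m * g n =
        (f m - g m) * f n + (f n - g n) * g m by ring]
      exact dvd_add (mul_dvd_mul (D _) (inM f h1 h3 _ hn)) (mul_dvd_mul (D _) (inM g h2 h4 _ hm))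
    | add m _ n _ h1 h2 =>
      rw [map_add, map_add, add_sub_add_comm]; exact dvd_add h1 h2
  have mk : ∀ b : S, t ∣ b → ∃ f : R →ₐ[k] S, f x = t ∧ f y = b := by
    rintro b ⟨e, rfl⟩
    apply lift
    · exact pow_eq_zero_of_le (min_le_left p q) ht
    · rw [mul_pow, pow_eq_zero_of_le (min_le_right p q) ht, zero_mul]
  have fu : ∀ f : R →ₐ[k] S, f x = t → f (c • x + d • y + w) =
      algebraMap k S c * t + algebraMap k S d * f y + f w := by
    intro f h1
    rw [map_add, map_add, map_smul, map_smul, h1, Algebra.smul_def, Algebra.smul_def]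
  have key : ∀ n : ℕ, ∃ f : R →ₐ[k] S, f x = t ∧ t ∣ f y ∧ t ^ (n+1) ∣ f (c • x + d • y + w) := by
    intro n
    induction n with
    | zero =>
      obtain ⟨f, h1, h2⟩ := mk 0 (dvd_zero _)
      have h3 : t ∣ f y := h2 ▸ dvd_zero _
      refine ⟨f, h1, h3, ?_⟩
      rw [fu f h1, zero_add, pow_one]
      exact dvd_add (dvd_add (dvd_mul_left _ _) (h3.mul_left _))
        ((dvd_mul_right t t).trans (inM2 f h1 h3 w hw))
    | succ n ih =>
      obtain ⟨f, h1, h2, h3⟩ := ih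
      have h4 : t ∣ f (c • x + d • y + w) := (dvd_pow_self t (Nat.succ_ne_zero n)).trans h3
      obtain ⟨g, g1, g2⟩ := mk (f y - algebraMap k S d⁻¹ * f (c • x + d • y + w))
        (dvd_sub h2 (h4.mul_left _))
      have g3 : t ∣ g y := g2 ▸ (dvd_sub h2 (h4.mul_left _))
      refine ⟨g, g1, g3, ?_⟩
      have D := diff2 g f g1 h1 g3 h2 w hw
      have e : g (c • x + d • y + w) = g w - f w := by
        have e1 := fu f h1
        rw [fu g g1, g2]
        linear_combination (-f (c • x + d • y + w)) * unit_d - e1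
      rw [e]
      refine dvd_trans ?_ D
      rw [pow_succ]
      refine mul_dvd_mul ?_ dvd_rfl
      rw [g2, sub_sub_cancel_left, dvd_neg]
      exact h3.mul_left _
  obtain ⟨f, h1, h2, h3⟩ := key (min p q)
  have h4 : f (c • x + d • y + w) = 0 := by
    rw [pow_succ, ht, zero_mul] at h3
    exact zero_dvd_iff.1 h3
  obtain ⟨v, hv⟩ := h
  have h5 : t ^ r * f y ^ s = 0 := by
    have := congrArg f hv
    rwa [map_mul, map_mul, map_pow, map_pow, h4, zero_mul, h1] at this
  rw [fu f h1] at h4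
  obtain ⟨e, he⟩ := inM2 f h1 h2 w hw
  have hU : IsUnit (algebraMap k S c + t * e) := by
    have hn : IsNilpotent (t * e) := ⟨min p q, by rw [mul_pow, ht, zero_mul]⟩
    exact hn.isUnit_add_left_of_commute ((IsUnit.mk0 c hc).map _) (Commute.all _ _)
  obtain ⟨g, hg⟩ := hU.exists_left_inv
  have h6 : t = (-(g * algebraMap k S d)) * f y := by
    rw [he] at h4
    linear_combination g * h4 - t * hg
  rw [pow_add]
  have : t ^ s = (-(g * algebraMap k S d)) ^ s * f y ^ s := by
    rw [← mul_pow, ← h6]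
  rw [this, mul_left_comm, h5, mul_zero]

theorem quot_nil (k : Type u) [Field k] (n : ℕ) :
    (Ideal.Quotient.mk (Ideal.span {(X : k[X]) ^ n}) X) ^ n = 0 := by
  rw [← map_pow]
  exact Ideal.Quotient.eq_zero_iff_mem.2 (Ideal.mem_span_singleton_self _)

theorem quot_lift (k : Type u) [Field k] (n : ℕ) {S : Type u} [CommRing S] [Algebra k S]
    (a : S) (ha : a ^ n = 0) :
    ∃ f : (k[X] ⧸ Ideal.span {(X : k[X]) ^ n}) →ₐ[k] S, f (Ideal.Quotient.mk _ X) = a := by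
  refine ⟨Ideal.Quotient.liftₐ _ (aeval a) ?_, ?_⟩
  · intro z hz
    obtain ⟨z, rfl⟩ := Ideal.mem_span_singleton.1 hz
    simp [ha]
  · exact aeval_X a

theorem quot_ext (k : Type u) [Field k] (n : ℕ) {S : Type u} [CommRing S] [Algebra k S]
    (f g : (k[X] ⧸ Ideal.span {(X : k[X]) ^ n}) →ₐ[k] S)
    (h : f (Ideal.Quotient.mk _ X) = g (Ideal.Quotient.mk _ X)) : f = g := by
  apply Ideal.Quotient.algHom_ext
  apply Polynomial.algHom_ext
  exact h

theorem aux_tensor {k : Type u} [Field k] (p q r s : ℕ) (c d : k) (hc : c ≠ 0) (hd : d ≠ 0)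
    {A B : Type u} [CommRing A] [Algebra k A] [CommRing B] [Algebra k B] (α : A) (β : B)
    (hα : α ^ p = 0) (hβ : β ^ q = 0)
    (liftA : ∀ {S : Type u} [CommRing S] [Algebra k S] (a : S), a ^ p = 0 →
      ∃ f : A →ₐ[k] S, f α = a)
    (liftB : ∀ {S : Type u} [CommRing S] [Algebra k S] (a : S), a ^ q = 0 →
      ∃ f : B →ₐ[k] S, f β = a)
    (extA : ∀ {S : Type u} [CommRing S] [Algebra k S] (f g : A →ₐ[k] S), f α = g α → f = g)
    (extB : ∀ {S : Type u} [CommRing S] [Algebra k S] (f g : B →ₐ[k] S), f β = g β → f = g)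
    (w : A ⊗[k] B) (hw : w ∈ (Ideal.span {α ⊗ₜ[k] (1 : B), (1 : A) ⊗ₜ[k] β}) ^ 2) :
    (c • (α ⊗ₜ[k] (1 : B)) + d • ((1 : A) ⊗ₜ[k] β) + w) ∣
      (α ⊗ₜ[k] (1 : B)) ^ r * ((1 : A) ⊗ₜ[k] β) ^ s ↔ min p q ≤ r + s := by
  constructor
  · intro h
    have h8 : (X : k[X]) ^ (min p q) ∣ X ^ (r + s) := by
      rw [← Ideal.mem_span_singleton, ← Ideal.Quotient.eq_zero_iff_mem, map_pow]
      refine aux_forw _ _ p q r s c d hd hc ?_ ?_ w hw h _ _ (min p q) rfl (quot_nil k _)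
      · intro S _ _ a b ha hb
        obtain ⟨f, hf⟩ := liftA a ha
        obtain ⟨g, hg⟩ := liftB b hb
        refine ⟨Algebra.TensorProduct.productMap f g, ?_, ?_⟩
        · simp [hf]
        · simp [hg]
      · intro S _ _ f g h1 h2
        apply Algebra.TensorProduct.ext
        · exact extA _ _ h1
        · exact extB _ _ h2
    exact (pow_dvd_pow_iff X_ne_zero not_isUnit_X).1 h8
  · refine aux_back _ _ p q r s c d hc hd ?_ ?_ w hw
    · rw [Algebra.TensorProduct.tmul_pow, hα, TensorProduct.zero_tmul]
    · rw [Algebra.TensorProduct.tmul_pow, hβ, TensorProduct.tmul_zero]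

/-- In `k[X]/(X^p) ⊗ k[Y]/(Y^q)`, for `u = c x + d y + w` with `c, d ≠ 0` and `w` in the
square of the maximal ideal `(x, y)`, `x^r y^s` is divisible by `u` iff `r + s ≥ min(p, q)`. -/
theorem stmt_4 (k : Type*) [Field k] (p q r s : ℕ) (c d : k) (hc : c ≠ 0) (hd : d ≠ 0) :
    let A := Polynomial k ⧸ Ideal.span {(X : Polynomial k) ^ p}
    let B := Polynomial k ⧸ Ideal.span {(X : Polynomial k) ^ q}
    let x : A ⊗[k] B := (Ideal.Quotient.mk _ X) ⊗ₜ 1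
    let y : A ⊗[k] B := 1 ⊗ₜ (Ideal.Quotient.mk _ X)
    ∀ w : A ⊗[k] B, w ∈ (Ideal.span {x, y}) ^ 2 →
      ((c • x + d • y + w) ∣ x ^ r * y ^ s ↔ min p q ≤ r + s) := by
  intro A B x y w hw
  exact aux_tensor p q r s c d hc hd (A := A) (B := B) _ _ (quot_nil k p) (quot_nil k q)
    (quot_lift k p) (quot_lift k q) (quot_ext k p) (quot_ext k q) w hw
end

section
/- Let k be an algebraically closed field and P, Q, R, S polynomials in k[X]. Let A = k[X]/(P), B = k[Y]/(Q), let U be in k[X,Y] and u = U(x, y) in A tensor_k B. Assume that for every alpha, beta in k with P(alpha) = Q(beta) = 0 and U(alpha, beta) = 0, both partial derivatives dU/dX(alpha, beta) and dU/dY(alpha, beta) are nonzero. Then u divides R(x)*S(y) in A tensor_k B if and only if for every such pair (alpha, beta), writing p, q, r, s for the multiplicities of alpha in P, beta in Q, alpha in R, beta in S respectively, one has r + s >= min(p, q). -/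
open TensorProduct Polynomial

theorem aux_decomp {k : Type*} [Field k] (α β : k) (U : MvPolynomial (Fin 2) k) :
    ∃ V W : MvPolynomial (Fin 2) k,
      U = MvPolynomial.C (MvPolynomial.eval ![α, β] U)
        + (MvPolynomial.X 0 - MvPolynomial.C α) * V
        + (MvPolynomial.X 1 - MvPolynomial.C β) * W := by
  induction U using MvPolynomial.induction_on with
  | C a => exact ⟨0, 0, by simp⟩
  | add p q hp hq =>
    obtain ⟨V, W, h⟩ := hp
    obtain ⟨V', W', h'⟩ := hq
    refine ⟨V + V', W + W', ?_⟩
    rw [map_add, map_add]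
    linear_combination h + h'
  | mul_X p i hp =>
    obtain ⟨V, W, h⟩ := hp
    fin_cases i
    · refine ⟨V * MvPolynomial.X 0 + MvPolynomial.C (MvPolynomial.eval ![α, β] p),
        W * MvPolynomial.X 0, ?_⟩
      simp only [Fin.zero_eta, map_mul, MvPolynomial.eval_X, Matrix.cons_val_zero]
      linear_combination (MvPolynomial.X 0) * h
    · refine ⟨V * MvPolynomial.X 1,
        W * MvPolynomial.X 1 + MvPolynomial.C (MvPolynomial.eval ![α, β] p), ?_⟩
      simp only [Fin.mk_one, map_mul, MvPolynomial.eval_X, Matrix.cons_val_one]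
      simp only [Matrix.cons_val_fin_one]
      linear_combination (MvPolynomial.X 1) * h

theorem aux_decomp' {k : Type*} [Field k] (α β : k) (U : MvPolynomial (Fin 2) k) :
    ∃ V W : MvPolynomial (Fin 2) k,
      U = MvPolynomial.C (MvPolynomial.eval ![α, β] U)
        + (MvPolynomial.X 0 - MvPolynomial.C α) * V
        + (MvPolynomial.X 1 - MvPolynomial.C β) * W ∧
      MvPolynomial.eval ![α, β] V = MvPolynomial.eval ![α, β] (MvPolynomial.pderiv 0 U) ∧
      MvPolynomial.eval ![α, β] W = MvPolynomial.eval ![α, β] (MvPolynomial.pderiv 1 U) := by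
  obtain ⟨V, W, h⟩ := aux_decomp α β U
  refine ⟨V, W, h, ?_, ?_⟩
  · rw [h]
    simp
  · rw [h]
    simp

theorem aux_aeval {k D : Type*} [Field k] [CommRing D] [Algebra k D] (α β : k)
    (U : MvPolynomial (Fin 2) k) (V W : MvPolynomial (Fin 2) k)
    (h : U = MvPolynomial.C (MvPolynomial.eval ![α, β] U)
        + (MvPolynomial.X 0 - MvPolynomial.C α) * V
        + (MvPolynomial.X 1 - MvPolynomial.C β) * W) (x y : D) :
    MvPolynomial.aeval ![x, y] U = algebraMap k D (MvPolynomial.eval ![α, β] U)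
      + (x - algebraMap k D α) * MvPolynomial.aeval ![x, y] V
      + (y - algebraMap k D β) * MvPolynomial.aeval ![x, y] W := by
  have := congrArg (MvPolynomial.aeval ![x, y]) h
  simpa [-MvPolynomial.algebraMap_eq] using this

theorem aux_mem {k D : Type*} [Field k] [CommRing D] [Algebra k D] (M : Ideal D)
    (α β : k) (x y : D) (hx : x - algebraMap k D α ∈ M) (hy : y - algebraMap k D β ∈ M)
    (U : MvPolynomial (Fin 2) k) :
    MvPolynomial.aeval ![x, y] U - algebraMap k D (MvPolynomial.eval ![α, β] U) ∈ M := by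
  obtain ⟨V, W, h⟩ := aux_decomp α β U
  rw [aux_aeval α β U V W h x y]
  have := M.add_mem (M.mul_mem_right (MvPolynomial.aeval ![x, y] V) hx)
    (M.mul_mem_right (MvPolynomial.aeval ![x, y] W) hy)
  convert this using 1
  ring

theorem aux_mem1 {k D : Type*} [Field k] [CommRing D] [Algebra k D] (M : Ideal D)
    (α : k) (x : D) (hx : x - algebraMap k D α ∈ M) (F : k[X]) :
    aeval x F - algebraMap k D (F.eval α) ∈ M := by
  have h : X - C α ∣ F - C (F.eval α) := by
    rw [dvd_iff_isRoot]; simp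
  obtain ⟨G, hG⟩ := h
  have := congrArg (aeval x) hG
  simp only [map_sub, map_mul, aeval_X, aeval_C] at this
  rw [this]
  exact M.mul_mem_right _ hx

theorem aux_scalar {k D : Type*} [Field k] [CommRing D] [Algebra k D] (M : Ideal D)
    (hM : M ≠ ⊤) (c : k) (h : algebraMap k D c ∈ M) : c = 0 := by
  by_contra hc
  exact hM (Ideal.eq_top_of_isUnit_mem M h ((IsUnit.mk0 c hc).map (algebraMap k D)))

theorem aux_notMem {k D : Type*} [Field k] [CommRing D] [Algebra k D] (M : Ideal D)
    (hM : M ≠ ⊤) (c : k) (z : D) (h : z - algebraMap k D c ∈ M) (hc : c ≠ 0) : z ∉ M := by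
  intro hz
  apply hc
  apply aux_scalar M hM
  have := M.sub_mem hz h
  simpa using this

theorem aux_unit {k D : Type*} [Field k] [CommRing D] [Algebra k D]
    (c : k) (z : D) (h : z - algebraMap k D c ∈ nilradical D) (hc : c ≠ 0) : IsUnit z := by
  have h1 : IsUnit (algebraMap k D c) := (IsUnit.mk0 c hc).map (algebraMap k D)
  have := IsNilpotent.isUnit_add_left_of_commute (mem_nilradical.1 h) h1 (Commute.all _ _)
  simpa using this

theorem aux_root {k D : Type*} [Field k] [IsAlgClosed k] [CommRing D] [Algebra k D] (M : Ideal D)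
    [hM : M.IsPrime] (P : k[X]) (hP : P ≠ 0) (x : D) (h : aeval x P ∈ M) :
    ∃ α : k, P.eval α = 0 ∧ x - algebraMap k D α ∈ M := by
  have h0 := (IsAlgClosed.splits P).eq_prod_roots
  have h1 := h
  rw [h0, map_mul, aeval_C] at h1
  rcases hM.mem_or_mem h1 with h2 | h2
  · have := aux_scalar M hM.ne_top _ h2
    exact absurd (leadingCoeff_eq_zero.1 this) hP
  · rw [map_multiset_prod, Multiset.map_map, hM.multiset_prod_mem_iff_exists_mem] at h2
    obtain ⟨z, hz, h3⟩ := h2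
    obtain ⟨a, ha, rfl⟩ := Multiset.mem_map.1 hz
    exact ⟨a, (mem_roots hP).1 ha, by simpa using h3⟩

theorem aux_fac {k D : Type*} [Field k] [CommRing D] [Algebra k D] (P : k[X]) (hP : P ≠ 0)
    (α : k) : ∃ P1 : k[X], P1.eval α ≠ 0 ∧
      ∀ x : D, aeval x P = (x - algebraMap k D α) ^ P.rootMultiplicity α * aeval x P1 := by
  obtain ⟨G, hG, hn⟩ := exists_eq_pow_rootMultiplicity_mul_and_not_dvd P hP α
  refine ⟨G, fun h => hn (dvd_iff_isRoot.2 h), fun x => ?_⟩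
  have := congrArg (aeval x) hG
  simpa using this

theorem aux_back_s5 {k D : Type*} [Field k] [IsAlgClosed k] [CommRing D] [Algebra k D]
    (P Q R S : k[X]) (hP : P ≠ 0) (hQ : Q ≠ 0) (hR : R ≠ 0) (hS : S ≠ 0)
    (U : MvPolynomial (Fin 2) k)
    (hder : ∀ α β : k, P.eval α = 0 → Q.eval β = 0 → MvPolynomial.eval ![α, β] U = 0 →
      MvPolynomial.eval ![α, β] (MvPolynomial.pderiv 0 U) ≠ 0 ∧
      MvPolynomial.eval ![α, β] (MvPolynomial.pderiv 1 U) ≠ 0)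
    (hm : ∀ α β : k, P.eval α = 0 → Q.eval β = 0 → MvPolynomial.eval ![α, β] U = 0 →
        min (P.rootMultiplicity α) (Q.rootMultiplicity β)
          ≤ R.rootMultiplicity α + S.rootMultiplicity β)
    (x y : D) (hx : aeval x P = 0) (hy : aeval y Q = 0)
    (hu : MvPolynomial.aeval ![x, y] U = 0) : aeval x R * aeval y S = 0 := by
  by_contra hne
  set w := aeval x R * aeval y S with hw
  have hJ : Ideal.torsionOf D D w ≠ ⊤ := by
    rw [Ne, Ideal.torsionOf_eq_top_iff]; exact hne
  obtain ⟨M, hM, hJM⟩ := Ideal.exists_le_maximal _ hJ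
  have hMp := hM.isPrime
  obtain ⟨α, hα, hxα⟩ := aux_root M P hP x (by rw [hx]; exact M.zero_mem)
  obtain ⟨β, hβ, hyβ⟩ := aux_root M Q hQ y (by rw [hy]; exact M.zero_mem)
  have hU0 : MvPolynomial.eval ![α, β] U = 0 := by
    apply aux_scalar M hM.ne_top
    have := aux_mem M α β x y hxα hyβ U
    rw [hu, zero_sub] at this
    exact M.neg_mem_iff.1 this
  obtain ⟨d0, d1⟩ := hder α β hα hβ hU0
  have hmin := hm α β hα hβ hU0
  obtain ⟨V, W, h, hV, hW⟩ := aux_decomp' α β U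
  have hrel := aux_aeval α β U V W h x y
  rw [hu, hU0, map_zero, zero_add] at hrel
  have hVM := aux_notMem M hM.ne_top _ _ (aux_mem M α β x y hxα hyβ V) (by rw [hV]; exact d0)
  have hWM := aux_notMem M hM.ne_top _ _ (aux_mem M α β x y hxα hyβ W) (by rw [hW]; exact d1)
  obtain ⟨P1, hP1, eP⟩ := aux_fac (D := D) P hP α
  obtain ⟨Q1, hQ1, eQ⟩ := aux_fac (D := D) Q hQ β
  obtain ⟨R1, hR1, eR⟩ := aux_fac (D := D) R hR α
  obtain ⟨S1, hS1, eS⟩ := aux_fac (D := D) S hS β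
  have hP1M := aux_notMem M hM.ne_top _ _ (aux_mem1 M α x hxα P1) hP1
  have hQ1M := aux_notMem M hM.ne_top _ _ (aux_mem1 M β y hyβ Q1) hQ1
  have eP := eP x
  have eQ := eQ y
  rw [eR x, eS y] at hw
  rw [hx] at eP
  rw [hy] at eQ
  generalize P.rootMultiplicity α = p at *
  generalize Q.rootMultiplicity β = q at *
  generalize R.rootMultiplicity α = r at *
  generalize S.rootMultiplicity β = s at *
  generalize x - algebraMap k D α = a at *
  generalize y - algebraMap k D β = b at *
  generalize MvPolynomial.aeval ![x, y] V = v at *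
  generalize MvPolynomial.aeval ![x, y] W = c at *
  generalize aeval x P1 = p1 at *
  generalize aeval y Q1 = q1 at *
  generalize aeval x R1 = r1 at *
  generalize aeval y S1 = s1 at *
  rcases min_le_iff.1 hmin with hle | hle
  · have : c ^ s * p1 ∈ Ideal.torsionOf D D w := by
      rw [Ideal.mem_torsionOf_iff, smul_eq_mul, hw]
      have e1 : c ^ s * b ^ s = (-v) ^ s * a ^ s := by
        rw [← mul_pow, ← mul_pow]; congr 1; linear_combination -hrel
      have e2 : a ^ (r + s) * p1 = 0 := by
        obtain ⟨n, hn⟩ := Nat.exists_eq_add_of_le hle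
        rw [hn, pow_add]; linear_combination -a ^ n * eP
      rw [pow_add] at e2
      linear_combination (p1 * a ^ r * r1 * s1) * e1 + ((-v) ^ s * r1 * s1) * e2
    rcases hMp.mem_or_mem (hJM this) with h | h
    · exact hWM (hMp.mem_of_pow_mem _ h)
    · exact hP1M h
  · have : v ^ r * q1 ∈ Ideal.torsionOf D D w := by
      rw [Ideal.mem_torsionOf_iff, smul_eq_mul, hw]
      have e1 : v ^ r * a ^ r = (-c) ^ r * b ^ r := by
        rw [← mul_pow, ← mul_pow]; congr 1; linear_combination -hrel
      have e2 : b ^ (r + s) * q1 = 0 := by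
        obtain ⟨n, hn⟩ := Nat.exists_eq_add_of_le hle
        rw [hn, pow_add]; linear_combination -b ^ n * eQ
      rw [pow_add] at e2
      linear_combination (q1 * b ^ s * r1 * s1) * e1 + ((-c) ^ r * r1 * s1) * e2
    rcases hMp.mem_or_mem (hJM this) with h | h
    · exact hVM (hMp.mem_of_pow_mem _ h)
    · exact hQ1M h

theorem aux_back' {k D : Type*} [Field k] [IsAlgClosed k] [CommRing D] [Algebra k D]
    (P Q R S : k[X]) (hP : P ≠ 0) (hQ : Q ≠ 0) (hR : R ≠ 0) (hS : S ≠ 0)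
    (U : MvPolynomial (Fin 2) k)
    (hder : ∀ α β : k, P.eval α = 0 → Q.eval β = 0 → MvPolynomial.eval ![α, β] U = 0 →
      MvPolynomial.eval ![α, β] (MvPolynomial.pderiv 0 U) ≠ 0 ∧
      MvPolynomial.eval ![α, β] (MvPolynomial.pderiv 1 U) ≠ 0)
    (hm : ∀ α β : k, P.eval α = 0 → Q.eval β = 0 → MvPolynomial.eval ![α, β] U = 0 →
        min (P.rootMultiplicity α) (Q.rootMultiplicity β)
          ≤ R.rootMultiplicity α + S.rootMultiplicity β)
    (x y : D) (hx : aeval x P = 0) (hy : aeval y Q = 0) :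
    MvPolynomial.aeval ![x, y] U ∣ aeval x R * aeval y S := by
  let I : Ideal D := Ideal.span {MvPolynomial.aeval ![x, y] U}
  let π : D →ₐ[k] D ⧸ I := Ideal.Quotient.mkₐ k I
  have hcomp : π (MvPolynomial.aeval ![x, y] U) = MvPolynomial.aeval ![π x, π y] U := by
    have : π.comp (MvPolynomial.aeval ![x, y]) = MvPolynomial.aeval ![π x, π y] := by
      apply MvPolynomial.algHom_ext
      intro i
      fin_cases i <;> simp
    exact DFunLike.congr_fun this U
  have key := aux_back_s5 P Q R S hP hQ hR hS U hder hm (π x) (π y)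
    (by rw [aeval_algHom_apply, hx, map_zero]) (by rw [aeval_algHom_apply, hy, map_zero])
    (by
      rw [← hcomp]
      exact Ideal.Quotient.eq_zero_iff_mem.2 (Ideal.mem_span_singleton_self _))
  rw [aeval_algHom_apply, aeval_algHom_apply, ← map_mul] at key
  exact Ideal.mem_span_singleton.1 (Ideal.Quotient.eq_zero_iff_mem.1 key)

/-- Newton step: a root of `U(α + t, ·)` near `β`, with `y - β` a unit multiple of `t`. -/
theorem aux_newton {k T : Type*} [Field k] [CommRing T] [Algebra k T] (α β : k)
    (U : MvPolynomial (Fin 2) k) (hU : MvPolynomial.eval ![α, β] U = 0)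
    (h0 : MvPolynomial.eval ![α, β] (MvPolynomial.pderiv 0 U) ≠ 0)
    (h1 : MvPolynomial.eval ![α, β] (MvPolynomial.pderiv 1 U) ≠ 0)
    (t : T) (ht : IsNilpotent t) :
    ∃ e : T, IsUnit e ∧
      MvPolynomial.aeval ![algebraMap k T α + t, algebraMap k T β + e * t] U = 0 := by
  obtain ⟨V, W, h, hV, hW⟩ := aux_decomp' α β U
  set x := algebraMap k T α + t with hx
  have hxn : x - algebraMap k T α ∈ nilradical T := by simpa [hx, mem_nilradical] using ht
  let F : MvPolynomial (Fin 2) k → T[X] := fun G =>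
    MvPolynomial.aeval (![C x, X] : Fin 2 → T[X]) G
  have hF : ∀ G (z : T), aeval z (F G) = MvPolynomial.aeval ![x, z] G := by
    intro G z
    have : ((aeval z : T[X] →ₐ[T] T).restrictScalars k).comp
        (MvPolynomial.aeval (![C x, X] : Fin 2 → T[X])) = MvPolynomial.aeval ![x, z] := by
      apply MvPolynomial.algHom_ext
      intro i
      fin_cases i <;> simp
    exact DFunLike.congr_fun this G
  set b := algebraMap k T β with hb
  have hbn : b - algebraMap k T β ∈ nilradical T := by simp [hb]
  have hFU : F U = C t * F V + (X - C b) * F W := by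
    have := aux_aeval α β U V W h (C x : T[X]) X
    rw [hU, map_zero, zero_add] at this
    simp only [F]
    rw [this]
    have e1 : ∀ c : k, algebraMap k T[X] c = C (algebraMap k T c) := fun c => rfl
    rw [e1, e1, ← C_sub, hx, add_sub_cancel_left]
  have hnil : IsNilpotent (aeval b (F U)) := by
    rw [hF]
    have := aux_mem (nilradical T) α β x b hxn hbn U
    rw [hU, map_zero, sub_zero] at this
    exact mem_nilradical.1 this
  have hun : IsUnit (aeval b (derivative (F U))) := by
    have : aeval b (derivative (F U)) = t * aeval b (derivative (F V)) + aeval b (F W) := by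
      rw [hFU]; simp [derivative_mul]
    rw [this, hF W b]
    refine aux_unit _ _ (?_ : _ - algebraMap k T (MvPolynomial.eval ![α, β] W) ∈ _)
      (by rw [hW]; exact h1)
    rw [add_sub_assoc]
    exact Ideal.add_mem _ (Ideal.mul_mem_right _ _ (mem_nilradical.2 ht))
      (aux_mem _ α β x b hxn hbn W)
  obtain ⟨y, ⟨hy1, hy2⟩, -⟩ := existsUnique_nilpotent_sub_and_aeval_eq_zero hnil hun
  rw [hF] at hy2
  have hyn : y - algebraMap k T β ∈ nilradical T := by
    rw [mem_nilradical, ← neg_sub]; exact hy1.neg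
  have uV : IsUnit (MvPolynomial.aeval ![x, y] V) :=
    aux_unit _ _ (aux_mem _ α β x y hxn hyn V) (by rw [hV]; exact h0)
  have uW : IsUnit (MvPolynomial.aeval ![x, y] W) :=
    aux_unit _ _ (aux_mem _ α β x y hxn hyn W) (by rw [hW]; exact h1)
  have hrel := aux_aeval α β U V W h x y
  rw [hy2, hU, map_zero, zero_add, hx, add_sub_cancel_left, ← hx, ← hb] at hrel
  obtain ⟨c, hc⟩ := uW
  refine ⟨-(MvPolynomial.aeval ![x, y] V) * ↑c⁻¹, (uV.neg).mul c⁻¹.isUnit, ?_⟩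
  have : b + -(MvPolynomial.aeval ![x, y] V) * ↑c⁻¹ * t = y := by
    rw [← hc] at hrel
    have e := c.inv_mul
    linear_combination (↑c⁻¹ : T) * hrel + (y - b) * e
  rw [this, hy2]

theorem aux_forw_s5 {k T : Type*} [Field k] [CommRing T] [Algebra k T] (α β : k)
    (R S : k[X]) (hR : R ≠ 0) (hS : S ≠ 0) (t e : T) (ht : IsNilpotent t) (he : IsUnit e)
    (h : aeval (algebraMap k T α + t) R * aeval (algebraMap k T β + e * t) S = 0) :
    t ^ (R.rootMultiplicity α + S.rootMultiplicity β) = 0 := by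
  obtain ⟨R1, hR1, eR⟩ := aux_fac (D := T) R hR α
  obtain ⟨S1, hS1, eS⟩ := aux_fac (D := T) S hS β
  have ht' := mem_nilradical.2 ht
  have uR : IsUnit (aeval (algebraMap k T α + t) R1) :=
    aux_unit _ _ (aux_mem1 _ α _ (by simpa using ht') R1) hR1
  have uS : IsUnit (aeval (algebraMap k T β + e * t) S1) :=
    aux_unit _ _ (aux_mem1 _ β _ (by simpa using Ideal.mul_mem_left _ e ht') S1) hS1
  rw [eR, eS, add_sub_cancel_left, add_sub_cancel_left] at h
  have hu := ((he.pow (S.rootMultiplicity β)).mul uR).mul uS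
  rw [← hu.mul_right_eq_zero, ← h]
  ring

theorem stmt_5 (k : Type*) [Field k] [IsAlgClosed k] (P Q R S : Polynomial k)
    (hP : P ≠ 0) (hQ : Q ≠ 0) (hR : R ≠ 0) (hS : S ≠ 0)
    (U : MvPolynomial (Fin 2) k)
    (hder : ∀ α β : k, P.eval α = 0 → Q.eval β = 0 → MvPolynomial.eval ![α, β] U = 0 →
      MvPolynomial.eval ![α, β] (MvPolynomial.pderiv 0 U) ≠ 0 ∧
      MvPolynomial.eval ![α, β] (MvPolynomial.pderiv 1 U) ≠ 0) :
    let A := Polynomial k ⧸ Ideal.span {P}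
    let B := Polynomial k ⧸ Ideal.span {Q}
    let x : A ⊗[k] B := (Ideal.Quotient.mk _ X) ⊗ₜ 1
    let y : A ⊗[k] B := 1 ⊗ₜ (Ideal.Quotient.mk _ X)
    (MvPolynomial.aeval ![x, y] U ∣ (Polynomial.aeval x R) * (Polynomial.aeval y S) ↔
      ∀ α β : k, P.eval α = 0 → Q.eval β = 0 → MvPolynomial.eval ![α, β] U = 0 →
        min (P.rootMultiplicity α) (Q.rootMultiplicity β)
          ≤ R.rootMultiplicity α + S.rootMultiplicity β) := by
  intro A B x y
  have hmk : ∀ (F G : k[X]), aeval (Ideal.Quotient.mk (Ideal.span {F}) X) G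
      = Ideal.Quotient.mk (Ideal.span {F}) G := by
    intro F G
    have := aeval_algHom_apply (Ideal.Quotient.mkₐ k (Ideal.span {F})) X G
    simpa using this
  have hmk0 : ∀ (F : k[X]), aeval (Ideal.Quotient.mk (Ideal.span {F}) X) F = 0 := by
    intro F
    rw [hmk, Ideal.Quotient.eq_zero_iff_mem]
    exact Ideal.mem_span_singleton_self F
  have hx : aeval x P = 0 := by
    have := aeval_algHom_apply (Algebra.TensorProduct.includeLeft : A →ₐ[k] A ⊗[k] B)
      (Ideal.Quotient.mk _ X) P
    rw [hmk0, map_zero] at this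
    exact this
  have hy : aeval y Q = 0 := by
    have := aeval_algHom_apply (Algebra.TensorProduct.includeRight : B →ₐ[k] A ⊗[k] B)
      (Ideal.Quotient.mk _ X) Q
    rw [hmk0, map_zero] at this
    exact this
  have hcomp : ∀ {T : Type _} [CommRing T] [Algebra k T] (f : A ⊗[k] B →ₐ[k] T),
      f (MvPolynomial.aeval ![x, y] U) = MvPolynomial.aeval ![f x, f y] U := by
    intro T _ _ f
    have : f.comp (MvPolynomial.aeval ![x, y]) = MvPolynomial.aeval ![f x, f y] := by
      apply MvPolynomial.algHom_ext
      intro i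
      fin_cases i <;> simp
    exact DFunLike.congr_fun this U
  constructor
  · intro hdvd α β hα hβ hU
    obtain ⟨d0, d1⟩ := hder α β hα hβ hU
    set m := min (P.rootMultiplicity α) (Q.rootMultiplicity β) with hm
    let T := k[X] ⧸ Ideal.span {(X : k[X]) ^ m}
    let t : T := Ideal.Quotient.mk _ X
    have htn : ∀ n, t ^ n = 0 ↔ m ≤ n := by
      intro n
      rw [← map_pow, Ideal.Quotient.eq_zero_iff_mem, Ideal.mem_span_singleton]
      exact pow_dvd_pow_iff X_ne_zero not_isUnit_X
    have ht : IsNilpotent t := ⟨m, (htn m).2 le_rfl⟩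
    obtain ⟨e, he, hUe⟩ := aux_newton α β U hU d0 d1 t ht
    rw [← htn]
    apply aux_forw_s5 α β R S hR hS t e ht he
    have hPT : aeval (algebraMap k T α + t) P = 0 := by
      obtain ⟨P1, -, eP⟩ := aux_fac (D := T) P hP α
      rw [eP, add_sub_cancel_left, (htn _).2 (min_le_left _ _), zero_mul]
    have hQT : aeval (algebraMap k T β + e * t) Q = 0 := by
      obtain ⟨Q1, -, eQ⟩ := aux_fac (D := T) Q hQ β
      rw [eQ, add_sub_cancel_left, mul_pow, (htn _).2 (min_le_right _ _), mul_zero, zero_mul]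
    have lift : ∀ (F : k[X]) (z : T), aeval z F = 0 →
        ∃ f : (k[X] ⧸ Ideal.span {F}) →ₐ[k] T, f (Ideal.Quotient.mk _ X) = z := by
      intro F z hz
      refine ⟨Ideal.Quotient.liftₐ (Ideal.span {F}) (aeval z) ?_, ?_⟩
      · intro a ha
        obtain ⟨c, rfl⟩ := Ideal.mem_span_singleton.1 ha
        rw [map_mul, hz, zero_mul]
      · exact aeval_X z
    obtain ⟨f, hf⟩ := lift P _ hPT
    obtain ⟨g, hg⟩ := lift Q _ hQT
    let φ : A ⊗[k] B →ₐ[k] T := Algebra.TensorProduct.productMap f g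
    have hφx : φ x = algebraMap k T α + t := by
      simp only [φ, x, Algebra.TensorProduct.productMap_apply_tmul, map_one, mul_one, hf]
    have hφy : φ y = algebraMap k T β + e * t := by
      simp only [φ, y, Algebra.TensorProduct.productMap_apply_tmul, map_one, one_mul, hg]
    have := map_dvd φ hdvd
    rw [hcomp φ, hφx, hφy, hUe, zero_dvd_iff, map_mul, ← aeval_algHom_apply,
      ← aeval_algHom_apply, hφx, hφy] at this
    exact this
  · intro hm
    exact aux_back' P Q R S hP hQ hR hS U hder hm x y hx hy
end

section
/- Let V be an F_2-vector space and F a linear subspace of V tensor F_2^n such that (Id tensor J_n)(F) is contained in F and F is contained in Ker(Id tensor c). Then (Id tensor S)(F) = {0}. -/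
open TensorProduct

/-- One-based coordinate form, zero outside the range. -/
def coordE (n k : ℕ) : (Fin n → ZMod 2) →ₗ[ZMod 2] ZMod 2 :=
  if h : 1 ≤ k ∧ k ≤ n then LinearMap.proj (⟨k - 1, by omega⟩ : Fin n) else 0

theorem coordE_sum (n k : ℕ) (y : Fin n → ZMod 2) :
    (∑ j : Fin n, if k = (j : ℕ) + 1 then y j else 0) = coordE n k y := by
  unfold coordE
  split_ifs with h
  · rw [Finset.sum_eq_single (⟨k - 1, by omega⟩ : Fin n)]
    · simp; omega
    · intro b _ hb
      rw [if_neg]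
      intro h'
      apply hb
      ext
      simp [h']
    · simp
  · apply Finset.sum_eq_zero
    intro j _
    rw [if_neg]
    have := j.2
    omega

theorem coordE_succ (n : ℕ) (i : Fin n) (y : Fin n → ZMod 2) :
    coordE n ((i : ℕ) + 1) y = y i := by
  unfold coordE
  rw [dif_pos ⟨by omega, i.2⟩]
  simp

theorem coordE_J (n : ℕ) (J : Matrix (Fin n) (Fin n) (ZMod 2))
    (hJ : ∀ i j : Fin n, J i j = if (i : ℕ) + 1 = j ∨ (j : ℕ) + 1 = i then 1 else 0)
    (k : ℕ) (hk : k < n) (y : Fin n → ZMod 2) :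
    coordE n (k + 1) (J.mulVecLin y) = coordE n k y + coordE n (k + 2) y := by
  have := coordE_succ n ⟨k, hk⟩ (J.mulVecLin y)
  simp only at this
  rw [this, ← coordE_sum, ← coordE_sum, ← Finset.sum_add_distrib, Matrix.mulVecLin_apply,
    Matrix.mulVec, dotProduct]
  apply Finset.sum_congr rfl
  intro j _
  rw [hJ]
  by_cases h1 : k + 1 = (j : ℕ)
  · have h2 : ¬ (k = (j : ℕ) + 1) := by omega
    simp [h1, h2]
  · by_cases h2 : k = (j : ℕ) + 1
    · simp [h2]
    · have h3 : ¬ (k + 2 = (j : ℕ) + 1) := by omega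
      have h4 : ¬ ((j : ℕ) + 1 = k) := by omega
      simp [h1, h2, h4]

theorem sum_coordE (n : ℕ) (y : Fin n → ZMod 2) :
    ∑ i, y i = ∑ k ∈ Finset.range n, coordE n (k + 1) y := by
  rw [Finset.sum_range]
  simp only [coordE_succ]

theorem telesc (g : ℕ → ZMod 2) (n : ℕ) :
    ∑ k ∈ Finset.range n, (g k + g (k + 2)) = g 0 + g 1 + g n + g (n + 1) := by
  induction n with
  | zero => simp; linear_combination -(CharTwo.add_self_eq_zero (g 0)) - (CharTwo.add_self_eq_zero (g 1))
  | succ n ih =>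
    rw [Finset.sum_range_succ, ih]
    linear_combination (CharTwo.add_self_eq_zero (g n))

/-- If a subspace `F ⊆ V ⊗ F_2ⁿ` is stable under `Id ⊗ J_n` and contained in
`Ker (Id ⊗ c)`, then `(Id ⊗ S)(F) = 0`, where `c` is the coordinate-sum map and `S` the
symmetrization map. -/
theorem stmt_18 (V : Type*) [AddCommGroup V] [Module (ZMod 2) V] (n : ℕ)
    (J : Matrix (Fin n) (Fin n) (ZMod 2))
    (hJ : ∀ i j : Fin n, J i j = if (i : ℕ) + 1 = j ∨ (j : ℕ) + 1 = i then 1 else 0)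
    (c : (Fin n → ZMod 2) →ₗ[ZMod 2] ZMod 2) (hcdef : ∀ y, c y = ∑ i, y i)
    (S : (Fin n → ZMod 2) →ₗ[ZMod 2] (Fin ((n + 1) / 2) → ZMod 2))
    (hSdef : ∀ y (i : Fin ((n + 1) / 2)), S y i =
      if 2 * (i : ℕ) + 1 = n then y (Fin.castLE (by omega) i)
      else y (Fin.castLE (by omega) i) + y (Fin.castLE (by omega : (n + 1) / 2 ≤ n) i).rev)
    (F : Submodule (ZMod 2) (V ⊗[ZMod 2] (Fin n → ZMod 2)))
    (hJF : Submodule.map (LinearMap.lTensor V J.mulVecLin) F ≤ F)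
    (hcF : F ≤ LinearMap.ker (LinearMap.lTensor V c)) :
    Submodule.map (LinearMap.lTensor V S) F = ⊥ := by
  classical
  let W : Submodule (ZMod 2) ((Fin n → ZMod 2) →ₗ[ZMod 2] ZMod 2) :=
    { carrier := {g | ∀ x ∈ F, LinearMap.lTensor V g x = 0}
      add_mem' := by
        intro a b ha hb x hx
        rw [LinearMap.lTensor_add, LinearMap.add_apply, ha x hx, hb x hx, add_zero]
      zero_mem' := by intro x _; simp
      smul_mem' := by
        intro r a ha x hx
        rw [LinearMap.lTensor_smul, LinearMap.smul_apply, ha x hx, smul_zero] }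
  have hWJ : ∀ g ∈ W, g ∘ₗ J.mulVecLin ∈ W := by
    intro g hg x hx
    rw [LinearMap.lTensor_comp, LinearMap.comp_apply]
    exact hg _ (hJF (Submodule.mem_map_of_mem hx))
  have hcW : c ∈ W := fun x hx => hcF hx
  have hf : ∀ k, k ≤ n → coordE n k + coordE n (n + 1 - k) ∈ W ∧
      coordE n (k + 1) + coordE n (n - k) ∈ W := by
    intro k
    induction k with
    | zero =>
      intro _
      have e0 : coordE n 0 = 0 := by simp [coordE]
      have e1 : coordE n (n + 1) = 0 := by simp [coordE]
      refine ⟨by simp [e0, e1], ?_⟩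
      convert hWJ c hcW using 1
      refine LinearMap.ext fun y => ?_
      simp only [LinearMap.add_apply, LinearMap.comp_apply]
      rw [hcdef, sum_coordE, Finset.sum_congr rfl
        (fun k hk => coordE_J n J hJ k (Finset.mem_range.1 hk) y),
        telesc (fun k => coordE n k y)]
      simp [e0, e1]
    | succ k ih =>
      intro hk
      obtain ⟨h1, h2⟩ := ih (by omega)
      have h3 : n + 1 - (k + 1) = n - k := by omega
      refine ⟨by rw [h3]; exact h2, ?_⟩
      have h4 := W.add_mem (hWJ _ h2) h1
      convert h4 using 1
      refine LinearMap.ext fun y => ?_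
      simp only [LinearMap.add_apply, LinearMap.comp_apply]
      obtain ⟨m, hm⟩ : ∃ m, n = k + 1 + m := ⟨n - (k + 1), by omega⟩
      have a1 : n - k = m + 1 := by omega
      have a2 : n - (k + 1) = m := by omega
      have a3 : n + 1 - k = m + 2 := by omega
      rw [a1, a2, a3, coordE_J n J hJ k (by omega), coordE_J n J hJ m (by omega)]
      linear_combination -(CharTwo.add_self_eq_zero (coordE n k y)) -
        (CharTwo.add_self_eq_zero (coordE n (m + 2) y))
  have hS : ∀ i, LinearMap.proj i ∘ₗ S ∈ W := by
    intro i
    by_cases hi : 2 * (i : ℕ) + 1 = n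
    · have hsum := W.add_mem hcW (W.sum_mem (t := Finset.range (i : ℕ))
        (fun k hk => (hf k (by have := Finset.mem_range.1 hk; omega)).2))
      convert hsum using 1
      refine LinearMap.ext fun y => ?_
      have h0 : coordE n ((i : ℕ) + 1) y = y (Fin.castLE (by omega) i) :=
        coordE_succ n (Fin.castLE (by omega) i) y
      simp only [LinearMap.add_apply, LinearMap.comp_apply, LinearMap.proj_apply, hSdef,
        if_pos hi, LinearMap.sum_apply, Finset.sum_add_distrib]
      rw [hcdef, sum_coordE, ← h0]
      have key : ∑ k ∈ Finset.range n, coordE n (k + 1) y =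
          (∑ k ∈ Finset.range (i : ℕ), coordE n (k + 1) y) + coordE n ((i : ℕ) + 1) y +
            ∑ k ∈ Finset.range (i : ℕ), coordE n (n - k) y := by
        have : Finset.range n = Finset.range (((i : ℕ) + 1) + (i : ℕ)) := by congr 1; omega
        rw [this, Finset.sum_range_add, Finset.sum_range_succ]
        congr 1
        rw [← Finset.sum_range_reflect]
        apply Finset.sum_congr rfl
        intro k hk
        have := Finset.mem_range.1 hk
        congr 2
        omega
      rw [key]
      linear_combination
        -(CharTwo.add_self_eq_zero (∑ k ∈ Finset.range (i : ℕ), coordE n (k + 1) y)) -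
        (CharTwo.add_self_eq_zero (∑ k ∈ Finset.range (i : ℕ), coordE n (n - k) y))
    · convert (hf (i : ℕ) (by omega)).2 using 1
      refine LinearMap.ext fun y => ?_
      have h0 : coordE n ((i : ℕ) + 1) y = y (Fin.castLE (by omega) i) :=
        coordE_succ n (Fin.castLE (by omega) i) y
      have h1 := coordE_succ n (Fin.castLE (by omega : (n + 1) / 2 ≤ n) i).rev y
      have h2 : (((Fin.castLE (by omega : (n + 1) / 2 ≤ n) i).rev : Fin n) : ℕ) + 1
          = n - (i : ℕ) := by
        simp [Fin.val_rev]; omega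
      rw [h2] at h1
      simp only [LinearMap.add_apply, LinearMap.comp_apply, LinearMap.proj_apply, hSdef,
        if_neg hi, h0, h1]
  have hdec : S = ∑ i, (LinearMap.single (ZMod 2) (fun _ => ZMod 2) i) ∘ₗ
      (LinearMap.proj i ∘ₗ S) := by
    refine LinearMap.ext fun y => ?_
    simp only [LinearMap.sum_apply, LinearMap.comp_apply, LinearMap.proj_apply,
      LinearMap.coe_single]
    exact (Finset.univ_sum_single (S y)).symm
  rw [eq_bot_iff]
  rintro _ ⟨x, hx, rfl⟩
  rw [Submodule.mem_bot, hdec, ← LinearMap.coe_lTensorHom, map_sum, LinearMap.sum_apply]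
  apply Finset.sum_eq_zero
  intro i _
  rw [LinearMap.coe_lTensorHom, LinearMap.lTensor_comp, LinearMap.comp_apply, hS i x hx, map_zero]
end
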